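/- Let d ≥ 1, c > 0, and let x⃗ : ℝ → ℝ^d be a smooth curve with |x⃗'(t)| < c for all t. Define j = b + (η(b, v)/c²) v and s = D j + (η(D j, v)/c²) v, where v = D x (x(t) = (c t, x⃗(t))), a = D v, b = D a. Set B⃗ = b⃗ + 3 γ² ((v⃗·a⃗)/c²) a⃗ and H⃗ = B⃗' + 3 γ² ((v⃗·a⃗)/c²) B⃗ + γ² ((v⃗·B⃗)/c²) a⃗. Then for every t: (i) s(t) = ((γ⁶/c)(v⃗·H⃗), γ⁴ M̂ H⃗); and (ii) H⃗ = h⃗ + 6 γ² ((v⃗·a⃗)/c²) b⃗ + (3 γ² |a⃗|²/c² + 4 γ² (v⃗·b⃗)/c² + 18 γ⁴ (v⃗·a⃗)²/c⁴) a⃗. -/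

import Mathlib

open scoped RealInnerProductSpace

/-- The Minkowski inner product on `ℝ × ℝ^d`: `η((s,u),(r,w)) = −s r + u·w`. -/
noncomputable def minkowski {d : ℕ} (Z W : ℝ × EuclideanSpace ℝ (Fin d)) : ℝ :=
  -(Z.1 * W.1) + ⟪Z.2, W.2⟫

/-- The component of `κ (c, v) + μ (0, u)` orthogonal to the four-velocity `g (c, v)`. -/
lemma minkowski_projection {d : ℕ} {c g : ℝ} (hc : 0 < c) {v : EuclideanSpace ℝ (Fin d)}
    (hg : g ^ 2 * (1 - ‖v‖ ^ 2 / c ^ 2) = 1) (κ μ : ℝ) (u : EuclideanSpace ℝ (Fin d))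
    (Z V : ℝ × EuclideanSpace ℝ (Fin d)) (hZ : Z = (κ * c, κ • v + μ • u))
    (hV : V = (g * c, g • v)) :
    Z + (minkowski Z V / c ^ 2) • V
      = (μ * g ^ 2 * ⟪v, u⟫ / c, μ • u + (μ * g ^ 2 * ⟪v, u⟫ / c ^ 2) • v) := by
  have hη : minkowski Z V / c ^ 2 * g = μ * g ^ 2 * ⟪v, u⟫ / c ^ 2 - κ := by
    simp only [minkowski, hZ, hV, inner_add_left, inner_smul_left, inner_smul_right,
      real_inner_self_eq_norm_sq, real_inner_comm v u, RCLike.conj_to_real]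
    field_simp at hg ⊢
    linear_combination (-κ) * hg
  have hη' : (minkowski Z V / c ^ 2) • V
      = ((μ * g ^ 2 * ⟪v, u⟫ / c ^ 2 - κ) * c, (μ * g ^ 2 * ⟪v, u⟫ / c ^ 2 - κ) • v) := by
    rw [← hη, hV]
    simp only [Prod.smul_mk, smul_eq_mul, smul_smul, mul_assoc]
  rw [hη', hZ, Prod.mk_add_mk]
  ext1
  · dsimp only
    field_simp
    ring
  · dsimp only
    module

lemma hasDerivAt_lorentzFactor {d : ℕ} {c : ℝ} (hc : 0 < c) {v : ℝ → EuclideanSpace ℝ (Fin d)}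
    {a : EuclideanSpace ℝ (Fin d)} {t : ℝ} (hv : HasDerivAt v a t) (hlt : ‖v t‖ < c) {γ : ℝ → ℝ}
    (hγ : ∀ t, γ t = (1 - ‖v t‖ ^ 2 / c ^ 2) ^ (-(1 / 2) : ℝ)) :
    γ t ^ 2 * (1 - ‖v t‖ ^ 2 / c ^ 2) = 1 ∧
      HasDerivAt γ (γ t ^ 3 * (⟪v t, a⟫ / c ^ 2)) t := by
  have hpos : 0 < 1 - ‖v t‖ ^ 2 / c ^ 2 := by
    rw [sub_pos, div_lt_one (by positivity)]
    gcongr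
  have hcube : γ t ^ 3 = (1 - ‖v t‖ ^ 2 / c ^ 2) ^ (-(1 / 2) - 1 : ℝ) := by
    rw [hγ, ← Real.rpow_natCast, ← Real.rpow_mul hpos.le]
    norm_num
  constructor
  · rw [hγ, ← Real.rpow_natCast, ← Real.rpow_mul hpos.le]
    norm_num
    rw [Real.rpow_neg_one, inv_mul_cancel₀ hpos.ne']
  · have h := (((hv.norm_sq).div_const (c ^ 2)).const_sub 1).rpow_const (p := -(1 / 2))
      (Or.inl hpos.ne')
    rw [show γ = fun t => (1 - ‖v t‖ ^ 2 / c ^ 2) ^ (-(1 / 2) : ℝ) from funext hγ] at hcube ⊢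
    refine h.congr_deriv ?_
    rw [hcube]
    ring

/-- Components of the relativistic snap in the lab frame: `s = ((γ⁶/c)(v⃗·H⃗), γ⁴ M̂ H⃗)`,
where `H⃗ = B⃗' + 3γ²((v⃗·a⃗)/c²) B⃗ + γ²((v⃗·B⃗)/c²) a⃗`, together with the explicit formula
`H⃗ = h⃗ + 6γ²((v⃗·a⃗)/c²) b⃗ + (3γ²|a⃗|²/c² + 4γ²(v⃗·b⃗)/c² + 18γ⁴(v⃗·a⃗)²/c⁴) a⃗`. -/
theorem relativistic_snap_components (d : ℕ) (hd : 1 ≤ d) (c : ℝ) (hc : 0 < c)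
    (xv : ℝ → EuclideanSpace ℝ (Fin d)) (hx : ContDiff ℝ (⊤ : ℕ∞) xv)
    (vv : ℝ → EuclideanSpace ℝ (Fin d)) (hvv : vv = deriv xv)
    (av : ℝ → EuclideanSpace ℝ (Fin d)) (hav : av = deriv vv)
    (bv : ℝ → EuclideanSpace ℝ (Fin d)) (hbv : bv = deriv av)
    (hv : ℝ → EuclideanSpace ℝ (Fin d)) (hhv : hv = deriv bv)
    (hspeed : ∀ t : ℝ, ‖vv t‖ < c)
    (γ : ℝ → ℝ) (hγ : ∀ t, γ t = (1 - ‖vv t‖ ^ 2 / c ^ 2) ^ (-(1 / 2) : ℝ))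
    (X : ℝ → ℝ × EuclideanSpace ℝ (Fin d)) (hX : ∀ t, X t = (c * t, xv t))
    (v4 : ℝ → ℝ × EuclideanSpace ℝ (Fin d)) (hv4 : ∀ t, v4 t = γ t • deriv X t)
    (a4 : ℝ → ℝ × EuclideanSpace ℝ (Fin d)) (ha4 : ∀ t, a4 t = γ t • deriv v4 t)
    (b4 : ℝ → ℝ × EuclideanSpace ℝ (Fin d)) (hb4 : ∀ t, b4 t = γ t • deriv a4 t)
    (j : ℝ → ℝ × EuclideanSpace ℝ (Fin d))
    (hj : ∀ t, j t = b4 t + (minkowski (b4 t) (v4 t) / c ^ 2) • v4 t)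
    (s : ℝ → ℝ × EuclideanSpace ℝ (Fin d))
    (hs : ∀ t, s t = γ t • deriv j t
      + (minkowski (γ t • deriv j t) (v4 t) / c ^ 2) • v4 t)
    (B : ℝ → EuclideanSpace ℝ (Fin d))
    (hB : ∀ t, B t = bv t + (3 * γ t ^ 2 * (⟪vv t, av t⟫ / c ^ 2)) • av t)
    (H : ℝ → EuclideanSpace ℝ (Fin d))
    (hH : ∀ t, H t = deriv B t + (3 * γ t ^ 2 * (⟪vv t, av t⟫ / c ^ 2)) • B t
      + (γ t ^ 2 * (⟪vv t, B t⟫ / c ^ 2)) • av t) :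
    ∀ t : ℝ,
      s t = ((γ t ^ 6 / c) * ⟪vv t, H t⟫,
        γ t ^ 4 • (H t + ((γ t ^ 2 / c ^ 2) * ⟪vv t, H t⟫) • vv t)) ∧
      H t = hv t + (6 * γ t ^ 2 * (⟪vv t, av t⟫ / c ^ 2)) • bv t
        + (3 * γ t ^ 2 * ‖av t‖ ^ 2 / c ^ 2 + 4 * γ t ^ 2 * ⟪vv t, bv t⟫ / c ^ 2
            + 18 * γ t ^ 4 * ⟪vv t, av t⟫ ^ 2 / c ^ 4) • av t := by
  have hvs : ContDiff ℝ (⊤ : ℕ∞) vv := hvv ▸ (contDiff_infty_iff_deriv.1 hx).2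
  have has : ContDiff ℝ (⊤ : ℕ∞) av := hav ▸ (contDiff_infty_iff_deriv.1 hvs).2
  have hbs : ContDiff ℝ (⊤ : ℕ∞) bv := hbv ▸ (contDiff_infty_iff_deriv.1 has).2
  have dx : ∀ t, HasDerivAt xv (vv t) t := fun t =>
    hvv ▸ (hx.differentiable (by simp) t).hasDerivAt
  have dv : ∀ t, HasDerivAt vv (av t) t := fun t =>
    hav ▸ (hvs.differentiable (by simp) t).hasDerivAt
  have da : ∀ t, HasDerivAt av (bv t) t := fun t =>
    hbv ▸ (has.differentiable (by simp) t).hasDerivAt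
  have db : ∀ t, HasDerivAt bv (hv t) t := fun t =>
    hhv ▸ (hbs.differentiable (by simp) t).hasDerivAt
  have hγ2 := fun t => (hasDerivAt_lorentzFactor hc (dv t) (hspeed t) hγ).1
  have dγ := fun t => (hasDerivAt_lorentzFactor hc (dv t) (hspeed t) hγ).2
  have dB : ∀ t, HasDerivAt B (hv t + ((3 * γ t ^ 2 * (⟪vv t, av t⟫ / c ^ 2)) • bv t
      + (6 * γ t ^ 4 * (⟪vv t, av t⟫ / c ^ 2) ^ 2
        + 3 * γ t ^ 2 * ((⟪vv t, bv t⟫ + ‖av t‖ ^ 2) / c ^ 2)) • av t)) t := by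
    intro t
    rw [show B = _ from funext hB]
    refine (db t).add (((((((dγ t).pow 2).const_mul 3).mul
      (((dv t).inner ℝ (da t)).div_const (c ^ 2))).smul (da t))).congr_deriv ?_)
    congr 2
    rw [real_inner_self_eq_norm_sq]
    push_cast [Pi.pow_apply]
    ring
  have ev : v4 = fun t => (γ t * c, γ t • vv t) := by
    funext t
    have h : HasDerivAt X (c * 1, vv t) t := by
      rw [show X = _ from funext hX]
      exact ((hasDerivAt_id t).const_mul c).prodMk (dx t)
    rw [hv4, h.deriv, Prod.smul_mk, mul_one, smul_eq_mul]
  obtain ⟨k, hk⟩ : ∃ k : ℝ → ℝ, k = fun t => γ t ^ 4 * (⟪vv t, av t⟫ / c ^ 2) := ⟨_, rfl⟩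
  have ea : a4 = fun t => (k t * c, k t • vv t + γ t ^ 2 • av t) := by
    funext t
    have h := ((dγ t).mul_const c).prodMk ((dγ t).fun_smul (dv t))
    rw [ha4, ev, HasDerivAt.deriv h, Prod.smul_mk, smul_eq_mul, hk]
    ext1
    · dsimp only
      ring
    · dsimp only
      module
  have dk : ∀ t, HasDerivAt k (deriv k t) t := by
    intro t
    rw [hk]
    exact (((dγ t).pow 4).mul (((dv t).inner ℝ (da t)).div_const
      (c ^ 2))).differentiableAt.hasDerivAt
  have eb : ∀ t, b4 t = ((γ t * deriv k t) * c,
      (γ t * deriv k t) • vv t + γ t ^ 3 • B t) := by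
    intro t
    have h := ((dk t).mul_const c).prodMk
      (((dk t).fun_smul (dv t)).fun_add (((dγ t).fun_pow 2).fun_smul (da t)))
    rw [hb4, ea, HasDerivAt.deriv h, Prod.smul_mk, smul_eq_mul, hB, hk]
    ext1
    · dsimp only
      ring
    · push_cast
      module
  obtain ⟨l, hl⟩ : ∃ l : ℝ → ℝ, l = fun t => γ t ^ 3 * γ t ^ 2 * ⟪vv t, B t⟫ / c ^ 2 := ⟨_, rfl⟩
  have ej : j = fun t => (l t * c, γ t ^ 3 • B t + l t • vv t) := by
    funext t
    rw [hj, minkowski_projection hc (hγ2 t) _ _ (B t) _ _ (eb t) (congrFun ev t), hl]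
    ext1
    · dsimp only
      field_simp
    · rfl
  have dl : ∀ t, HasDerivAt l (deriv l t) t := by
    intro t
    rw [hl]
    exact (((((dγ t).pow 3).mul ((dγ t).pow 2)).mul ((dv t).inner ℝ (dB t))).div_const
      (c ^ 2)).differentiableAt.hasDerivAt
  have eDj : ∀ t, γ t • deriv j t = ((γ t * deriv l t) * c,
      (γ t * deriv l t) • vv t + γ t ^ 4 • H t) := by
    intro t
    have h := ((dl t).mul_const c).prodMk
      ((((dγ t).fun_pow 3).fun_smul (dB t)).fun_add ((dl t).fun_smul (dv t)))
    rw [ej, HasDerivAt.deriv h, Prod.smul_mk, smul_eq_mul, hH, (dB t).deriv]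
    have hlt : l t = γ t ^ 5 * (⟪vv t, B t⟫ / c ^ 2) := by
      rw [hl]
      ring
    ext1
    · dsimp only
      ring
    · simp only [hlt]
      push_cast
      module
  intro t
  constructor
  · rw [hs, minkowski_projection hc (hγ2 t) _ _ (H t) _ _ (eDj t) (congrFun ev t)]
    ext1
    · dsimp only
      ring
    · dsimp only
      module
  · have hvB : ⟪vv t, B t⟫ = ⟪vv t, bv t⟫
        + 3 * γ t ^ 2 * (⟪vv t, av t⟫ / c ^ 2) * ⟪vv t, av t⟫ := by
      rw [hB, inner_add_right, inner_smul_right]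
    rw [hH, (dB t).deriv, hvB, hB]
    module
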